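/- Let (A, φ) and (Ã, φ̃) be two classical solutions of the chevron system on [0,T] with 0 ≤ c₁ < 1. If A(0,·) = Ã(0,·) and φ(0,·) = φ̃(0,·), then A(t,·) = Ã(t,·) and φ(t,·) = φ̃(t,·) for all t ∈ [0,T]. -/

import Mathlib

open MeasureTheory Set

noncomputable section

/-- Partial derivative of `f : ℝ × ℝ → E` in the first (x) variable. -/
def pdx {E : Type*} [NormedAddCommGroup E] [NormedSpace ℝ E]
    (f : ℝ × ℝ → E) (p : ℝ × ℝ) : E :=
  fderiv ℝ f p (1, 0)

/-- Partial derivative of `f : ℝ × ℝ → E` in the second (y) variable. -/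
def pdy {E : Type*} [NormedAddCommGroup E] [NormedSpace ℝ E]
    (f : ℝ × ℝ → E) (p : ℝ × ℝ) : E :=
  fderiv ℝ f p (0, 1)

/-- Laplacian of `f : ℝ × ℝ → E`. -/
def lap {E : Type*} [NormedAddCommGroup E] [NormedSpace ℝ E]
    (f : ℝ × ℝ → E) (p : ℝ × ℝ) : E :=
  pdx (pdx f) p + pdy (pdy f) p

/-- Squared `L²(Ω)` norm of `f`. -/
def l2sq {E : Type*} [NormedAddCommGroup E] [NormedSpace ℝ E]
    (Ω : Set (ℝ × ℝ)) (f : ℝ × ℝ → E) : ℝ :=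
  ∫ p in Ω, ‖f p‖ ^ 2

/-- Squared `L²(Ω)` norm of the gradient of `f`, i.e. `‖∂ₓ f‖² + ‖∂_y f‖²`. -/
def gradl2sq {E : Type*} [NormedAddCommGroup E] [NormedSpace ℝ E]
    (Ω : Set (ℝ × ℝ)) (f : ℝ × ℝ → E) : ℝ :=
  ∫ p in Ω, (‖pdx f p‖ ^ 2 + ‖pdy f p‖ ^ 2)

/-- A classical solution of the chevron pattern system on `[0,T]`:
`A, φ` are `C¹` in time (jointly continuously in `(t,x,y)`), `C²` in the space
variables, compactly supported in `Ω` uniformly in time, and satisfy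
`τ ∂ₜA = A + ΔA − φ²A − |A|²A − 2i c₁ φ ∂_yA + iβ A ∂_yφ` and
`∂ₜφ = D₁∂ₓ²φ + D₂∂_y²φ − hφ + φ|A|² − c₂ Im(A* ∂_yA)` pointwise on `Ω`. -/
structure IsChevronSolution (Ω : Set (ℝ × ℝ)) (T τ D₁ D₂ h c₁ c₂ β : ℝ)
    (A : ℝ → ℝ × ℝ → ℂ) (φ : ℝ → ℝ × ℝ → ℝ) : Prop where
  smooth_A : ContDiff ℝ 1 (fun q : ℝ × (ℝ × ℝ) => A q.1 q.2)
  smooth_φ : ContDiff ℝ 1 (fun q : ℝ × (ℝ × ℝ) => φ q.1 q.2)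
  space_A : ∀ t ∈ Icc (0 : ℝ) T, ContDiff ℝ 2 (A t)
  space_φ : ∀ t ∈ Icc (0 : ℝ) T, ContDiff ℝ 2 (φ t)
  support : ∃ K : Set (ℝ × ℝ), IsCompact K ∧ K ⊆ Ω ∧
    ∀ t, Function.support (A t) ⊆ K ∧ Function.support (φ t) ⊆ K
  eq_A : ∀ t ∈ Icc (0 : ℝ) T, ∀ p ∈ Ω,
    (τ : ℂ) * deriv (fun s => A s p) t =
      A t p + lap (A t) p - (φ t p : ℂ) ^ 2 * A t p - (‖A t p‖ ^ 2 : ℝ) * A t p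
        - 2 * Complex.I * (c₁ : ℂ) * (φ t p : ℂ) * pdy (A t) p
        + Complex.I * (β : ℂ) * A t p * ((pdy (φ t) p : ℝ) : ℂ)
  eq_φ : ∀ t ∈ Icc (0 : ℝ) T, ∀ p ∈ Ω,
    deriv (fun s => φ s p) t =
      D₁ * pdx (pdx (φ t)) p + D₂ * pdy (pdy (φ t)) p - h * φ t p
        + φ t p * ‖A t p‖ ^ 2 - c₂ * ((starRingEnd ℂ) (A t p) * pdy (A t) p).im


lemma chev_alg0 (L u v w z D₂ : ℝ) (hL0 : 0 ≤ L) (hD₂ : 0 < D₂) :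
    u * (L * (u + v + w + z)) + v * (L * (u + v + w + z)) ≤
      (2 * L + L ^ 2 + L ^ 2 / D₂) * (u ^ 2 + v ^ 2) + w ^ 2 + D₂ * z ^ 2 := by
  have e1 : 0 ≤ L * (u - v) ^ 2 := by positivity
  have e2 : 0 ≤ (L * (u + v) - 2 * w) ^ 2 + L ^ 2 * (u - v) ^ 2 + 2 * L ^ 2 * (u ^ 2 + v ^ 2) := by
    positivity
  have e3 : 0 ≤ ((L * (u + v) - 2 * D₂ * z) ^ 2 + L ^ 2 * (u - v) ^ 2
      + 2 * L ^ 2 * (u ^ 2 + v ^ 2)) / (4 * D₂) := by positivity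
  have : ((2 * L + L ^ 2 + L ^ 2 / D₂) * (u ^ 2 + v ^ 2) + w ^ 2 + D₂ * z ^ 2)
      - (u * (L * (u + v + w + z)) + v * (L * (u + v + w + z)))
      = L * (u - v) ^ 2 + ((L * (u + v) - 2 * w) ^ 2 + L ^ 2 * (u - v) ^ 2
        + 2 * L ^ 2 * (u ^ 2 + v ^ 2)) / 4
      + ((L * (u + v) - 2 * D₂ * z) ^ 2 + L ^ 2 * (u - v) ^ 2
        + 2 * L ^ 2 * (u ^ 2 + v ^ 2)) / (4 * D₂) := by
    field_simp; ring
  linarith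

set_option maxHeartbeats 1000000 in
lemma chev_alg1 (c₁ c₂ β h D₂ M : ℝ) (hD₂ : 0 < D₂) (hc₂ : 0 < c₂) (hc₁ : 0 ≤ c₁) (hh : 0 < h)
    (hM : 0 ≤ M) : ∃ C : ℝ, 0 ≤ C ∧ ∀ (a a' ay ay' : ℂ) (f f' fy fy' : ℝ),
    ‖a‖ ≤ M → ‖a'‖ ≤ M → ‖ay'‖ ≤ M → |f| ≤ M → |f'| ≤ M → |fy'| ≤ M →
    inner ℝ (a - a') ((a - (f : ℂ) ^ 2 * a - (‖a‖ ^ 2 : ℝ) * a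
        - 2 * Complex.I * (c₁ : ℂ) * (f : ℂ) * ay + Complex.I * (β : ℂ) * a * (fy : ℂ))
      - (a' - (f' : ℂ) ^ 2 * a' - (‖a'‖ ^ 2 : ℝ) * a'
        - 2 * Complex.I * (c₁ : ℂ) * (f' : ℂ) * ay' + Complex.I * (β : ℂ) * a' * (fy' : ℂ)))
    + (f - f') * ((- h * f + f * ‖a‖ ^ 2 - c₂ * ((starRingEnd ℂ) a * ay).im)
      - (- h * f' + f' * ‖a'‖ ^ 2 - c₂ * ((starRingEnd ℂ) a' * ay').im))
    ≤ C * (‖a - a'‖ ^ 2 + (f - f') ^ 2) + ‖ay - ay'‖ ^ 2 + D₂ * (fy - fy') ^ 2 := by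
  set L : ℝ := 1 + 3 * M ^ 2 + 2 * M ^ 2 + 2 * c₁ * M + |β| * M + h + c₂ * M with hL
  have hL0 : 0 ≤ L := by positivity
  refine ⟨2 * L + L ^ 2 + L ^ 2 / D₂, by positivity, ?_⟩
  intro a a' ay ay' f f' fy fy' h1 h2 h3 h4 h5 h6
  set u := ‖a - a'‖ with hu
  set v := |f - f'| with hv
  set w := ‖ay - ay'‖ with hw
  set z := |fy - fy'| with hz
  have hu0 : 0 ≤ u := norm_nonneg _
  have hv0 : 0 ≤ v := abs_nonneg _
  have hw0 : 0 ≤ w := norm_nonneg _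
  have hz0 : 0 ≤ z := abs_nonneg _
  have hna : |‖a‖ - ‖a'‖| ≤ u := abs_norm_sub_norm_le a a'
  have hsq : |‖a‖ ^ 2 - ‖a'‖ ^ 2| ≤ 2 * M * u := by
    rw [show ‖a‖ ^ 2 - ‖a'‖ ^ 2 = (‖a‖ + ‖a'‖) * (‖a‖ - ‖a'‖) by ring, abs_mul]
    gcongr
    rw [abs_of_nonneg (by positivity)]; linarith
  have hff : |f + f'| ≤ 2 * M := (abs_add_le _ _).trans (by linarith)
  -- bound on R
  have hR : ‖((a - (f : ℂ) ^ 2 * a - (‖a‖ ^ 2 : ℝ) * a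
        - 2 * Complex.I * (c₁ : ℂ) * (f : ℂ) * ay + Complex.I * (β : ℂ) * a * (fy : ℂ))
      - (a' - (f' : ℂ) ^ 2 * a' - (‖a'‖ ^ 2 : ℝ) * a'
        - 2 * Complex.I * (c₁ : ℂ) * (f' : ℂ) * ay' + Complex.I * (β : ℂ) * a' * (fy' : ℂ)))‖
      ≤ L * (u + v + w + z) := by
    have e : ((a - (f : ℂ) ^ 2 * a - (‖a‖ ^ 2 : ℝ) * a
        - 2 * Complex.I * (c₁ : ℂ) * (f : ℂ) * ay + Complex.I * (β : ℂ) * a * (fy : ℂ))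
      - (a' - (f' : ℂ) ^ 2 * a' - (‖a'‖ ^ 2 : ℝ) * a'
        - 2 * Complex.I * (c₁ : ℂ) * (f' : ℂ) * ay' + Complex.I * (β : ℂ) * a' * (fy' : ℂ)))
      = (a - a') - ((f ^ 2 : ℝ) : ℂ) * (a - a') - (((f + f') * (f - f') : ℝ) : ℂ) * a'
        - ((‖a‖ ^ 2 : ℝ) : ℂ) * (a - a') - ((‖a‖ ^ 2 - ‖a'‖ ^ 2 : ℝ) : ℂ) * a'
        - Complex.I * ((2 * c₁ * f : ℝ) : ℂ) * (ay - ay')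
        - Complex.I * ((2 * c₁ * (f - f') : ℝ) : ℂ) * ay'
        + Complex.I * ((β * (fy - fy') : ℝ) : ℂ) * a
        + Complex.I * ((β * fy' : ℝ) : ℂ) * (a - a') := by
      push_cast; ring
    rw [e]
    have t1 : ‖((f ^ 2 : ℝ) : ℂ) * (a - a')‖ ≤ M ^ 2 * u := by
      rw [norm_mul, Complex.norm_real, Real.norm_eq_abs, abs_pow]; gcongr
    have t2 : ‖(((f + f') * (f - f') : ℝ) : ℂ) * a'‖ ≤ (2 * M * v) * M := by
      rw [norm_mul, Complex.norm_real, Real.norm_eq_abs, abs_mul]; gcongr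
    have t3 : ‖((‖a‖ ^ 2 : ℝ) : ℂ) * (a - a')‖ ≤ M ^ 2 * u := by
      rw [norm_mul, Complex.norm_real, Real.norm_eq_abs, abs_of_nonneg (by positivity)]; gcongr
    have t4 : ‖((‖a‖ ^ 2 - ‖a'‖ ^ 2 : ℝ) : ℂ) * a'‖ ≤ (2 * M * u) * M := by
      rw [norm_mul, Complex.norm_real, Real.norm_eq_abs]; gcongr
    have t5 : ‖Complex.I * ((2 * c₁ * f : ℝ) : ℂ) * (ay - ay')‖ ≤ 2 * c₁ * M * w := by
      rw [norm_mul, norm_mul, Complex.norm_I, one_mul, Complex.norm_real, Real.norm_eq_abs,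
        abs_mul, abs_of_nonneg (by positivity : 0 ≤ 2 * c₁)]; gcongr
    have t6 : ‖Complex.I * ((2 * c₁ * (f - f') : ℝ) : ℂ) * ay'‖ ≤ 2 * c₁ * v * M := by
      rw [norm_mul, norm_mul, Complex.norm_I, one_mul, Complex.norm_real, Real.norm_eq_abs,
        abs_mul, abs_of_nonneg (by positivity : 0 ≤ 2 * c₁)]; gcongr
    have t7 : ‖Complex.I * ((β * (fy - fy') : ℝ) : ℂ) * a‖ ≤ |β| * z * M := by
      rw [norm_mul, norm_mul, Complex.norm_I, one_mul, Complex.norm_real, Real.norm_eq_abs,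
        abs_mul]; gcongr
    have t8 : ‖Complex.I * ((β * fy' : ℝ) : ℂ) * (a - a')‖ ≤ |β| * M * u := by
      rw [norm_mul, norm_mul, Complex.norm_I, one_mul, Complex.norm_real, Real.norm_eq_abs,
        abs_mul]; gcongr
    have : L * (u + v + w + z) - (u + M ^ 2 * u + (2 * M * v) * M + M ^ 2 * u + (2 * M * u) * M
      + 2 * c₁ * M * w + 2 * c₁ * v * M + |β| * z * M + |β| * M * u) =
      (1 * (v + w + z) + M ^ 2 * (u + 3 * v + 5 * w + 5 * z) + 2 * c₁ * M * (u + z)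
        + |β| * M * (v + w) + h * (u + v + w + z) + c₂ * M * (u + v + w + z)) := by
      rw [hL]; ring
    have : 0 ≤ (1 * (v + w + z) + M ^ 2 * (u + 3 * v + 5 * w + 5 * z) + 2 * c₁ * M * (u + z)
        + |β| * M * (v + w) + h * (u + v + w + z) + c₂ * M * (u + v + w + z)) := by positivity
    refine (norm_add_le_of_le (norm_add_le_of_le (norm_sub_le_of_le (norm_sub_le_of_le
      (norm_sub_le_of_le (norm_sub_le_of_le (norm_sub_le_of_le (norm_sub_le_of_le le_rfl t1) t2)
        t3) t4) t5) t6) t7) t8).trans ?_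
    linarith
  have hS : |((- h * f + f * ‖a‖ ^ 2 - c₂ * ((starRingEnd ℂ) a * ay).im)
      - (- h * f' + f' * ‖a'‖ ^ 2 - c₂ * ((starRingEnd ℂ) a' * ay').im))|
      ≤ L * (u + v + w + z) := by
    have e : ((- h * f + f * ‖a‖ ^ 2 - c₂ * ((starRingEnd ℂ) a * ay).im)
      - (- h * f' + f' * ‖a'‖ ^ 2 - c₂ * ((starRingEnd ℂ) a' * ay').im))
      = - h * (f - f') + (f - f') * ‖a‖ ^ 2 + f' * (‖a‖ ^ 2 - ‖a'‖ ^ 2)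
        - c₂ * ((starRingEnd ℂ) a * (ay - ay')).im - c₂ * ((starRingEnd ℂ) (a - a') * ay').im := by
      simp only [map_sub, sub_mul, mul_sub, Complex.sub_im]; ring
    rw [e]
    have t1 : |- h * (f - f')| ≤ h * v := by
      rw [abs_mul, abs_neg, abs_of_pos hh]
    have t2 : |(f - f') * ‖a‖ ^ 2| ≤ v * M ^ 2 := by
      rw [abs_mul, abs_of_nonneg (by positivity : 0 ≤ ‖a‖ ^ 2)]; gcongr
    have t3 : |f' * (‖a‖ ^ 2 - ‖a'‖ ^ 2)| ≤ M * (2 * M * u) := by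
      rw [abs_mul]; gcongr
    have t4 : |c₂ * ((starRingEnd ℂ) a * (ay - ay')).im| ≤ c₂ * (M * w) := by
      rw [abs_mul, abs_of_pos hc₂]; gcongr
      refine (Complex.abs_im_le_norm _).trans ?_
      rw [norm_mul, RCLike.norm_conj]; gcongr
    have t5 : |c₂ * ((starRingEnd ℂ) (a - a') * ay').im| ≤ c₂ * (u * M) := by
      rw [abs_mul, abs_of_pos hc₂]; gcongr
      refine (Complex.abs_im_le_norm _).trans ?_
      rw [norm_mul, RCLike.norm_conj]; gcongr
    have e2 : L * (u + v + w + z) - (h * v + v * M ^ 2 + M * (2 * M * u) + c₂ * (M * w)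
      + c₂ * (u * M)) = (1 + 2 * c₁ * M + |β| * M) * (u + v + w + z) + h * (u + w + z)
        + M ^ 2 * (3 * u + 4 * v + 5 * w + 5 * z) + c₂ * M * (v + z) := by
      rw [hL]; ring
    have : 0 ≤ (1 + 2 * c₁ * M + |β| * M) * (u + v + w + z) + h * (u + w + z)
        + M ^ 2 * (3 * u + 4 * v + 5 * w + 5 * z) + c₂ * M * (v + z) := by positivity
    simp only [← Real.norm_eq_abs] at t1 t2 t3 t4 t5 ⊢
    refine (norm_sub_le_of_le (norm_sub_le_of_le (norm_add_le_of_le (norm_add_le_of_le t1 t2)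
      t3) t4) t5).trans ?_
    linarith
  have i1 := (real_inner_le_norm (a - a') _).trans (mul_le_mul_of_nonneg_left hR hu0)
  have i2 := (le_abs_self _).trans ((abs_mul (f - f') _).le.trans
    (mul_le_mul_of_nonneg_left hS hv0))
  refine (add_le_add i1 i2).trans ?_
  have hv2 : (f - f') ^ 2 = v ^ 2 := (sq_abs _).symm
  have hz2 : (fy - fy') ^ 2 = z ^ 2 := (sq_abs _).symm
  rw [hv2, hz2]
  exact chev_alg0 L u v w z D₂ hL0 hD₂



lemma chev_cd_fderiv {E : Type*} [NormedAddCommGroup E] [NormedSpace ℝ E]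
    {f : ℝ × ℝ → E} (hf : ContDiff ℝ 2 f) (v : ℝ × ℝ) :
    ContDiff ℝ 1 (fun p => fderiv ℝ f p v) :=
  (hf.fderiv_right (m := 1) (by norm_num)).clm_apply contDiff_const

lemma chev_ibp {E : Type*} [NormedAddCommGroup E] [InnerProductSpace ℝ E]
    {f : ℝ × ℝ → E} (hf : ContDiff ℝ 2 f) (hc : HasCompactSupport f) (v : ℝ × ℝ) :
    Integrable (fun p => inner ℝ (f p) (fderiv ℝ (fun q => fderiv ℝ f q v) p v)) ∧
    Integrable (fun p => ‖fderiv ℝ f p v‖ ^ 2) ∧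
    ∫ p, inner ℝ (f p) (fderiv ℝ (fun q => fderiv ℝ f q v) p v) =
      - ∫ p, ‖fderiv ℝ f p v‖ ^ 2 := by
  have hg := chev_cd_fderiv hf v
  have hgc : HasCompactSupport (fun p => fderiv ℝ f p v) := hc.fderiv_apply (𝕜 := ℝ) v
  have hg' : Continuous (fun p => fderiv ℝ (fun q => fderiv ℝ f q v) p v) :=
    (hg.continuous_fderiv one_ne_zero).clm_apply continuous_const
  have i1 : Integrable (fun p => inner ℝ (f p) (fderiv ℝ (fun q => fderiv ℝ f q v) p v)) := by
    refine (hf.continuous.inner hg').integrable_of_hasCompactSupport ?_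
    refine hc.mono fun p hp => ?_
    contrapose! hp
    simp only [Function.mem_support, not_not] at hp ⊢
    simp [hp]
  have i2 : Integrable (fun p => inner ℝ (fderiv ℝ f p v) (fderiv ℝ f p v)) := by
    refine (hg.continuous.inner hg.continuous).integrable_of_hasCompactSupport ?_
    refine hgc.mono fun p hp => ?_
    contrapose! hp
    simp only [Function.mem_support, not_not] at hp ⊢
    simp [hp]
  have i3 : Integrable (fun p => inner ℝ (f p) (fderiv ℝ f p v)) := by
    refine (hf.continuous.inner hg.continuous).integrable_of_hasCompactSupport ?_
    refine hc.mono fun p hp => ?_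
    contrapose! hp
    simp only [Function.mem_support, not_not] at hp ⊢
    simp [hp]
  refine ⟨i1, by simpa only [real_inner_self_eq_norm_sq] using i2, ?_⟩
  have key : ∫ p, inner ℝ (f p) (fderiv ℝ (fun q => fderiv ℝ f q v) p v) =
      - ∫ p, inner ℝ (fderiv ℝ f p v) (fderiv ℝ f p v) :=
    integral_bilinear_fderiv_right_eq_neg_left_of_integrable (μ := (volume : Measure (ℝ × ℝ)))
    (f := f) (g := fun q => fderiv ℝ f q v) (v := v) (B := innerSL ℝ) i2 i1 i3
    (fun x _ => (hf.differentiable two_ne_zero) x) (fun x _ => (hg.differentiable one_ne_zero) x)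
  simpa only [real_inner_self_eq_norm_sq] using key

lemma chev_bound {E : Type*} [NormedAddCommGroup E] {K : Set (ℝ × ℝ)} (hK : IsCompact K)
    {F : ℝ × (ℝ × ℝ) → E} (hF : Continuous F) (h0 : ∀ t, ∀ p ∉ K, F (t, p) = 0) (a b : ℝ) :
    ∃ M, 0 ≤ M ∧ ∀ t ∈ Icc a b, ∀ p, ‖F (t, p)‖ ≤ M := by
  obtain ⟨M, hM⟩ := (isCompact_Icc (a := a) (b := b)).prod hK |>.exists_bound_of_continuousOn
    hF.continuousOn
  refine ⟨max M 0, le_max_right _ _, fun t ht p => ?_⟩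
  by_cases hp : p ∈ K
  · exact (hM (t, p) ⟨ht, hp⟩).trans (le_max_left _ _)
  · rw [h0 t p hp]; simp

lemma chev_time_hasDerivAt {E : Type*} [NormedAddCommGroup E] [NormedSpace ℝ E]
    {F : ℝ → ℝ × ℝ → E} (hF : ContDiff ℝ 1 (fun q : ℝ × (ℝ × ℝ) => F q.1 q.2))
    (t : ℝ) (p : ℝ × ℝ) :
    HasDerivAt (fun s => F s p) (fderiv ℝ (fun q : ℝ × (ℝ × ℝ) => F q.1 q.2) (t, p) (1, 0)) t := by
  have h1 := (hF.differentiable one_ne_zero (t, p)).hasFDerivAt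
  exact h1.comp_hasDerivAt (f := fun s : ℝ => (s, p)) t
    ((hasDerivAt_id t).prodMk (hasDerivAt_const t p))

lemma chev_space_fderiv {E : Type*} [NormedAddCommGroup E] [NormedSpace ℝ E]
    {F : ℝ → ℝ × ℝ → E} (hF : ContDiff ℝ 1 (fun q : ℝ × (ℝ × ℝ) => F q.1 q.2))
    (t : ℝ) (p v : ℝ × ℝ) :
    fderiv ℝ (F t) p v = fderiv ℝ (fun q : ℝ × (ℝ × ℝ) => F q.1 q.2) (t, p) (0, v) := by
  have h1 := (hF.differentiable one_ne_zero (t, p)).hasFDerivAt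
  have h2 := h1.comp (f := fun s : ℝ × ℝ => (t, s)) p
    ((hasFDerivAt_const t p).prodMk (hasFDerivAt_id p))
  have h3 : HasFDerivAt (F t) _ p := h2
  rw [h3.fderiv]; rfl

lemma chev_diff_int {K : Set (ℝ × ℝ)} (hK : IsCompact K)
    {F : ℝ → ℝ × ℝ → ℝ} (hF : ContDiff ℝ 1 (fun q : ℝ × (ℝ × ℝ) => F q.1 q.2))
    (h0 : ∀ t, ∀ p ∉ K, F t p = 0) (t : ℝ) :
    Integrable (fun p => deriv (fun s => F s p) t) ∧
    HasDerivAt (fun s => ∫ p, F s p) (∫ p, deriv (fun s => F s p) t) t := by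
  set G : ℝ × (ℝ × ℝ) → ℝ :=
    fun q => fderiv ℝ (fun q : ℝ × (ℝ × ℝ) => F q.1 q.2) q (1, 0) with hG
  have hGc : Continuous G := (hF.continuous_fderiv one_ne_zero).clm_apply continuous_const
  have hd : ∀ s p, HasDerivAt (fun s => F s p) (G (s, p)) s := chev_time_hasDerivAt hF
  have hG0 : ∀ s, ∀ p ∉ K, G (s, p) = 0 := by
    intro s p hp
    rw [← (hd s p).deriv]
    simp [h0 _ p hp]
  obtain ⟨M, hM0, hM⟩ := chev_bound hK hGc hG0 (t - 1) (t + 1)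
  have hint : ∀ s, Integrable (F s) := fun s => by
    refine Continuous.integrable_of_hasCompactSupport ?_ (HasCompactSupport.intro hK (h0 s))
    exact hF.continuous.comp (Continuous.prodMk_right s)
  have hb : Integrable (K.indicator (fun _ : ℝ × ℝ => M)) := by
    rw [integrable_indicator_iff hK.measurableSet]
    exact integrableOn_const hK.measure_lt_top.ne
  have := hasDerivAt_integral_of_dominated_loc_of_deriv_le (μ := (volume : Measure (ℝ × ℝ)))
    (F := F) (x₀ := t) (s := Icc (t - 1) (t + 1)) (F' := fun s p => G (s, p))
    (bound := K.indicator (fun _ : ℝ × ℝ => M))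
    (Icc_mem_nhds (by linarith) (by linarith))
    (Filter.Eventually.of_forall fun s => (hint s).aestronglyMeasurable) (hint t)
    ((hGc.comp (Continuous.prodMk_right t)).aestronglyMeasurable)
    (Filter.Eventually.of_forall fun p s hs => by
      by_cases hp : p ∈ K
      · simpa [hp] using hM s hs p
      · simp [hp, hG0 s p hp]) hb
    (Filter.Eventually.of_forall fun p s hs => hd s p)
  simpa only [(hd _ _).deriv] using this

lemma chev_gronwall {E E' : ℝ → ℝ} {C T : ℝ} (hE : ∀ t, HasDerivAt E (E' t) t)
    (hE' : ∀ t ∈ Icc 0 T, E' t ≤ C * E t) (h0 : E 0 = 0) : ∀ t ∈ Icc 0 T, E t ≤ 0 := by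
  have hd : ∀ t, HasDerivAt (fun t => Real.exp (-C * t) * E t)
      (Real.exp (-C * t) * (E' t - C * E t)) t := by
    intro t
    have h1 : HasDerivAt (fun t : ℝ => -C * t) (-C) t := by
      simpa using (hasDerivAt_id t).const_mul (-C)
    refine (h1.exp.fun_mul (hE t)).congr_deriv ?_
    ring
  have ha : AntitoneOn (fun t => Real.exp (-C * t) * E t) (Icc 0 T) := by
    refine antitoneOn_of_deriv_nonpos (convex_Icc 0 T)
      (fun t _ => (hd t).continuousAt.continuousWithinAt)
      (fun t _ => (hd t).differentiableAt.differentiableWithinAt) ?_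
    intro t ht
    rw [(hd t).deriv]
    have := hE' t (interior_subset ht)
    exact mul_nonpos_of_nonneg_of_nonpos (Real.exp_pos _).le (by linarith)
  intro t ht
  have := ha ⟨le_rfl, ht.1.trans ht.2⟩ ht ht.1
  simp only [h0, mul_zero] at this
  exact nonpos_of_mul_nonpos_right this (Real.exp_pos _)

lemma chev_support_fderiv {E : Type*} [NormedAddCommGroup E] [NormedSpace ℝ E]
    {K : Set (ℝ × ℝ)} (hK : IsCompact K) {f : ℝ × ℝ → E} (hf : Function.support f ⊆ K)
    (v : ℝ × ℝ) : ∀ p ∉ K, fderiv ℝ f p v = 0 := by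
  intro p hp
  have : p ∉ Function.support (fderiv ℝ f) := fun h =>
    hp (closure_minimal hf hK.isClosed (support_fderiv_subset ℝ h))
  simp only [Function.mem_support, not_not] at this
  simp [this]

lemma chev_fderiv_bound {E : Type*} [NormedAddCommGroup E] [NormedSpace ℝ E]
    {K : Set (ℝ × ℝ)} (hK : IsCompact K) {F : ℝ → ℝ × ℝ → E}
    (hF : ContDiff ℝ 1 (fun q : ℝ × (ℝ × ℝ) => F q.1 q.2))
    (h0 : ∀ t, Function.support (F t) ⊆ K) (a b : ℝ) :
    ∃ M, 0 ≤ M ∧ ∀ t ∈ Icc a b, ∀ p, ‖F t p‖ ≤ M ∧ ‖pdy (F t) p‖ ≤ M := by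
  obtain ⟨M1, h1, h1'⟩ := chev_bound hK hF.continuous
    (fun t p hp => by simpa using fun h => hp (h0 t h)) a b
  obtain ⟨M2, h2, h2'⟩ := chev_bound hK
    (F := fun q => fderiv ℝ (fun q : ℝ × (ℝ × ℝ) => F q.1 q.2) q (0, (0, 1)))
    ((hF.continuous_fderiv one_ne_zero).clm_apply continuous_const)
    (fun t p hp => by
      rw [← chev_space_fderiv hF]; exact chev_support_fderiv hK (h0 t) _ p hp) a b
  refine ⟨max M1 M2, h1.trans (le_max_left _ _), fun t ht p => ⟨?_, ?_⟩⟩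
  · exact (h1' t ht p).trans (le_max_left _ _)
  · have := h2' t ht p
    rw [← chev_space_fderiv hF] at this
    exact this.trans (le_max_right _ _)

lemma chev_sub_fderiv {E : Type*} [NormedAddCommGroup E] [NormedSpace ℝ E]
    {f g : ℝ × ℝ → E} (hf : ContDiff ℝ 2 f) (hg : ContDiff ℝ 2 g) (v : ℝ × ℝ) (p : ℝ × ℝ) :
    fderiv ℝ (fun q => f q - g q) p v = fderiv ℝ f p v - fderiv ℝ g p v ∧
    fderiv ℝ (fun q => fderiv ℝ (fun q => f q - g q) q v) p v =
      fderiv ℝ (fun q => fderiv ℝ f q v) p v - fderiv ℝ (fun q => fderiv ℝ g q v) p v := by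
  have h1 : ∀ p, fderiv ℝ (fun q => f q - g q) p v = fderiv ℝ f p v - fderiv ℝ g p v := by
    intro p
    rw [fderiv_fun_sub (hf.differentiable two_ne_zero p) (hg.differentiable two_ne_zero p)]
    rfl
  refine ⟨h1 p, ?_⟩
  simp only [h1]
  rw [fderiv_fun_sub ((chev_cd_fderiv hf v).differentiable one_ne_zero p)
    ((chev_cd_fderiv hg v).differentiable one_ne_zero p)]
  rfl

set_option maxHeartbeats 1000000 in
/-- uniqueness of classical solutions of the chevron system
when `0 ≤ c₁ < 1`. -/
theorem chevron_uniqueness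
    (Ω : Set (ℝ × ℝ)) (hΩ_open : IsOpen Ω) (hΩ_ne : Ω.Nonempty)
    (hΩ_bdd : Bornology.IsBounded Ω)
    (T τ D₁ D₂ h c₁ c₂ β : ℝ) (hT : 0 ≤ T) (hτ : 0 < τ)
    (hD₁ : 0 < D₁) (hD₂ : 0 < D₂) (hh : 0 < h) (hc₂ : 0 < c₂)
    (hc₁0 : 0 ≤ c₁) (hc₁1 : c₁ < 1)
    (A A' : ℝ → ℝ × ℝ → ℂ) (φ φ' : ℝ → ℝ × ℝ → ℝ)
    (hsol : IsChevronSolution Ω T τ D₁ D₂ h c₁ c₂ β A φ)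
    (hsol' : IsChevronSolution Ω T τ D₁ D₂ h c₁ c₂ β A' φ')
    (hA0 : A 0 = A' 0) (hφ0 : φ 0 = φ' 0) :
    ∀ t ∈ Icc (0 : ℝ) T, A t = A' t ∧ φ t = φ' t := by
  obtain ⟨K1, hK1, hK1Ω, hs1⟩ := hsol.support
  obtain ⟨K2, hK2, hK2Ω, hs2⟩ := hsol'.support
  set K := K1 ∪ K2 with hKdef
  have hK : IsCompact K := hK1.union hK2
  have hKΩ : K ⊆ Ω := union_subset hK1Ω hK2Ω
  have sA : ∀ t, Function.support (A t) ⊆ K := fun t => (hs1 t).1.trans subset_union_left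
  have sφ : ∀ t, Function.support (φ t) ⊆ K := fun t => (hs1 t).2.trans subset_union_left
  have sA' : ∀ t, Function.support (A' t) ⊆ K := fun t => (hs2 t).1.trans subset_union_right
  have sφ' : ∀ t, Function.support (φ' t) ⊆ K := fun t => (hs2 t).2.trans subset_union_right
  -- uniform bounds
  obtain ⟨M1, hM1, b1⟩ := chev_fderiv_bound hK hsol.smooth_A sA 0 T
  obtain ⟨M2, hM2, b2⟩ := chev_fderiv_bound hK hsol.smooth_φ sφ 0 T
  obtain ⟨M3, hM3, b3⟩ := chev_fderiv_bound hK hsol'.smooth_A sA' 0 T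
  obtain ⟨M4, hM4, b4⟩ := chev_fderiv_bound hK hsol'.smooth_φ sφ' 0 T
  obtain ⟨C, hC0, hC⟩ := chev_alg1 c₁ c₂ β h D₂ (M1 + M2 + M3 + M4) hD₂ hc₂ hc₁0 hh (by positivity)
  -- differences
  set B : ℝ → ℝ × ℝ → ℂ := fun t p => A t p - A' t p with hB
  set ψ : ℝ → ℝ × ℝ → ℝ := fun t p => φ t p - φ' t p with hψ
  have cB : ContDiff ℝ 1 (fun q : ℝ × (ℝ × ℝ) => B q.1 q.2) := hsol.smooth_A.sub hsol'.smooth_A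
  have cψ : ContDiff ℝ 1 (fun q : ℝ × (ℝ × ℝ) => ψ q.1 q.2) := hsol.smooth_φ.sub hsol'.smooth_φ
  have B0 : ∀ t, ∀ p ∉ K, B t p = 0 := fun t p hp => by
    have h1 : A t p = 0 := by simpa using fun h => hp (sA t h)
    have h2 : A' t p = 0 := by simpa using fun h => hp (sA' t h)
    simp [hB, h1, h2]
  have ψ0 : ∀ t, ∀ p ∉ K, ψ t p = 0 := fun t p hp => by
    have h1 : φ t p = 0 := by simpa using fun h => hp (sφ t h)
    have h2 : φ' t p = 0 := by simpa using fun h => hp (sφ' t h)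
    simp [hψ, h1, h2]
  set F : ℝ → ℝ × ℝ → ℝ := fun t p => τ * ‖B t p‖ ^ 2 + ψ t p ^ 2 with hF
  have cF : ContDiff ℝ 1 (fun q : ℝ × (ℝ × ℝ) => F q.1 q.2) :=
    (contDiff_const.mul (cB.norm_sq ℝ)).add (cψ.pow 2)
  have F0 : ∀ t, ∀ p ∉ K, F t p = 0 := fun t p hp => by simp [hF, B0 t p hp, ψ0 t p hp]
  have dA : ∀ t p, HasDerivAt (fun s => B s p)
      (deriv (fun s => A s p) t - deriv (fun s => A' s p) t) t := fun t p =>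
    ((chev_time_hasDerivAt hsol.smooth_A t p).differentiableAt.hasDerivAt).fun_sub
    ((chev_time_hasDerivAt hsol'.smooth_A t p).differentiableAt.hasDerivAt)
  have dφ : ∀ t p, HasDerivAt (fun s => ψ s p)
      (deriv (fun s => φ s p) t - deriv (fun s => φ' s p) t) t := fun t p =>
    ((chev_time_hasDerivAt hsol.smooth_φ t p).differentiableAt.hasDerivAt).fun_sub
    ((chev_time_hasDerivAt hsol'.smooth_φ t p).differentiableAt.hasDerivAt)
  have dF : ∀ t p, deriv (fun s => F s p) t =
      2 * (inner ℝ (B t p) ((τ : ℂ) * deriv (fun s => A s p) t - (τ : ℂ) * deriv (fun s => A' s p) t)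
       + ψ t p * (deriv (fun s => φ s p) t - deriv (fun s => φ' s p) t)) := by
    intro t p
    have := (((dA t p).norm_sq).const_mul τ).fun_add ((dφ t p).fun_pow 2)
    rw [this.deriv, ← mul_sub, ← Complex.real_smul, inner_smul_right]
    push_cast
    ring
  have cBt : ∀ t, Continuous (B t) := fun t => cB.continuous.comp (Continuous.prodMk_right t)
  have cψt : ∀ t, Continuous (ψ t) := fun t => cψ.continuous.comp (Continuous.prodMk_right t)
  have cFt : ∀ t, Continuous (F t) := fun t => cF.continuous.comp (Continuous.prodMk_right t)
  have hBc : ∀ t, HasCompactSupport (B t) := fun t => HasCompactSupport.intro hK (B0 t)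
  have hψc : ∀ t, HasCompactSupport (ψ t) := fun t => HasCompactSupport.intro hK (ψ0 t)
  have hFc : ∀ t, HasCompactSupport (F t) := fun t => HasCompactSupport.intro hK (F0 t)
  have hFi : ∀ t, Integrable (F t) := fun t => (cFt t).integrable_of_hasCompactSupport (hFc t)
  have hder := chev_diff_int hK cF F0
  set Q : ℝ := 2 * C * (1 / τ + 1) with hQ
  have main : ∀ t ∈ Icc (0 : ℝ) T, ∫ p, deriv (fun s => F s p) t ≤ Q * ∫ p, F t p := by
    intro t ht
    have hA2 := hsol.space_A t ht
    have hA2' := hsol'.space_A t ht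
    have hφ2 := hsol.space_φ t ht
    have hφ2' := hsol'.space_φ t ht
    have hB2 : ContDiff ℝ 2 (B t) := hA2.sub hA2'
    have hψ2 : ContDiff ℝ 2 (ψ t) := hφ2.sub hφ2'
    obtain ⟨i1, j1, e1⟩ := chev_ibp hB2 (hBc t) (1, 0)
    obtain ⟨i2, j2, e2⟩ := chev_ibp hB2 (hBc t) (0, 1)
    obtain ⟨i3, j3, e3⟩ := chev_ibp hψ2 (hψc t) (1, 0)
    obtain ⟨i4, j4, e4⟩ := chev_ibp hψ2 (hψc t) (0, 1)
    have pw : ∀ p, deriv (fun s => F s p) t ≤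
        2 * (inner ℝ (B t p) (fderiv ℝ (fun q => fderiv ℝ (B t) q (1, 0)) p (1, 0))
          + inner ℝ (B t p) (fderiv ℝ (fun q => fderiv ℝ (B t) q (0, 1)) p (0, 1))
          + D₁ * inner ℝ (ψ t p) (fderiv ℝ (fun q => fderiv ℝ (ψ t) q (1, 0)) p (1, 0))
          + D₂ * inner ℝ (ψ t p) (fderiv ℝ (fun q => fderiv ℝ (ψ t) q (0, 1)) p (0, 1))
          + ‖fderiv ℝ (B t) p (0, 1)‖ ^ 2 + D₂ * ‖fderiv ℝ (ψ t) p (0, 1)‖ ^ 2) + Q * F t p := by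
      intro p
      have hQF : 2 * C * (‖B t p‖ ^ 2 + ψ t p ^ 2) ≤ Q * F t p := by
        have : Q * F t p - 2 * C * (‖B t p‖ ^ 2 + ψ t p ^ 2)
          = 2 * C * (τ * ‖B t p‖ ^ 2 + 1 / τ * ψ t p ^ 2) := by
          simp only [hQ, hF]; field_simp; ring
        have : 0 ≤ 2 * C * (τ * ‖B t p‖ ^ 2 + 1 / τ * ψ t p ^ 2) := by positivity
        linarith
      by_cases hp : p ∈ Ω
      · rw [dF, hsol.eq_A t ht p hp, hsol'.eq_A t ht p hp, hsol.eq_φ t ht p hp,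
          hsol'.eq_φ t ht p hp]
        have key := hC (A t p) (A' t p) (pdy (A t) p) (pdy (A' t) p) (φ t p) (φ' t p)
          (pdy (φ t) p) (pdy (φ' t) p)
          ((b1 t ht p).1.trans (by linarith)) ((b3 t ht p).1.trans (by linarith))
          ((b3 t ht p).2.trans (by linarith)) ((b2 t ht p).1.trans (by linarith))
          ((b4 t ht p).1.trans (by linarith)) ((b4 t ht p).2.trans (by linarith))
        obtain ⟨-, xB⟩ := chev_sub_fderiv hA2 hA2' (1, 0) p
        obtain ⟨yB1, yB⟩ := chev_sub_fderiv hA2 hA2' (0, 1) p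
        obtain ⟨-, xψ⟩ := chev_sub_fderiv hφ2 hφ2' (1, 0) p
        obtain ⟨yψ1, yψ⟩ := chev_sub_fderiv hφ2 hφ2' (0, 1) p
        have xB' : fderiv ℝ (fun q => fderiv ℝ (B t) q (1, 0)) p (1, 0)
          = pdx (pdx (A t)) p - pdx (pdx (A' t)) p := xB
        have yB' : fderiv ℝ (fun q => fderiv ℝ (B t) q (0, 1)) p (0, 1)
          = pdy (pdy (A t)) p - pdy (pdy (A' t)) p := yB
        have xψ' : fderiv ℝ (fun q => fderiv ℝ (ψ t) q (1, 0)) p (1, 0)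
          = pdx (pdx (φ t)) p - pdx (pdx (φ' t)) p := xψ
        have yψ' : fderiv ℝ (fun q => fderiv ℝ (ψ t) q (0, 1)) p (0, 1)
          = pdy (pdy (φ t)) p - pdy (pdy (φ' t)) p := yψ
        have yB1' : fderiv ℝ (B t) p (0, 1) = pdy (A t) p - pdy (A' t) p := yB1
        have yψ1' : fderiv ℝ (ψ t) p (0, 1) = pdy (φ t) p - pdy (φ' t) p := yψ1
        rw [xB', yB', xψ', yψ', yB1', yψ1']
        have i0 : ∀ x y : ℝ, inner ℝ x y = x * y := fun x y => by simp [mul_comm]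
        rw [i0, i0, Real.norm_eq_abs, sq_abs]
        have hBp : B t p = A t p - A' t p := rfl
        have hψp : ψ t p = φ t p - φ' t p := rfl
        rw [← hBp, ← hψp] at key
        refine le_trans (le_of_eq ?_) (add_le_add (mul_le_mul_of_nonneg_left
          (add_le_add_right key
          (inner ℝ (B t p) (pdx (pdx (A t)) p - pdx (pdx (A' t)) p)
          + inner ℝ (B t p) (pdy (pdy (A t)) p - pdy (pdy (A' t)) p)
          + D₁ * (ψ t p * (pdx (pdx (φ t)) p - pdx (pdx (φ' t)) p))
          + D₂ * (ψ t p * (pdy (pdy (φ t)) p - pdy (pdy (φ' t)) p))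
          - C * (‖B t p‖ ^ 2 + ψ t p ^ 2))) zero_le_two) hQF) |>.trans (le_of_eq ?_)
        · simp only [lap, inner_add_right, inner_sub_right]
          ring
        · ring
      · have hpK : p ∉ K := fun h => hp (hKΩ h)
        rw [dF, B0 t p hpK, ψ0 t p hpK]
        have : 0 ≤ Q * F t p := by rw [F0 t p hpK]; simp
        simp only [inner_zero_left, zero_mul, mul_zero, add_zero, zero_add]
        positivity
    have k3 := i3.const_mul D₁
    have k4 := i4.const_mul D₂
    have l4 := j4.const_mul D₂
    have kF := (hFi t).const_mul Q
    refine (integral_mono (hder t).1 (((((((i1.add i2).add k3).add k4).add j2).add l4).const_mul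
      2).add kF) pw).trans ?_
    have eq := integral_add' (((((((i1.add i2).add k3).add k4).add j2).add l4).const_mul 2)) kF
    rw [eq, integral_const_mul, integral_const_mul,
      integral_add' ((((i1.add i2).add k3).add k4).add j2) l4,
      integral_add' (((i1.add i2).add k3).add k4) j2,
      integral_add' ((i1.add i2).add k3) k4,
      integral_add' (i1.add i2) k3,
      integral_add' i1 i2, integral_const_mul, integral_const_mul, integral_const_mul,
      e1, e2, e3, e4]
    have n1 : 0 ≤ ∫ p, ‖fderiv ℝ (B t) p (1, 0)‖ ^ 2 := integral_nonneg fun p => by positivity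
    have n3 : 0 ≤ D₁ * ∫ p, ‖fderiv ℝ (ψ t) p (1, 0)‖ ^ 2 :=
      mul_nonneg hD₁.le (integral_nonneg fun p => by positivity)
    linarith
  have hz := chev_gronwall (fun t => (hder t).2) main (by
    have : ∀ p, F 0 p = 0 := fun p => by simp [hF, hB, hψ, hA0, hφ0]
    simp [this])
  intro t ht
  have hall : ∀ p, F t p = 0 := by
    intro p
    by_contra hne
    have := (cFt t).integral_pos_of_hasCompactSupport_nonneg_nonzero (μ := volume) (hFc t)
      (fun p => by simp only [hF, Pi.zero_apply]; positivity) hne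
    exact absurd (hz t ht) (not_le.mpr this)
  have hfin : ∀ p, A t p = A' t p ∧ φ t p = φ' t p := by
    intro p
    have h1 : τ * ‖B t p‖ ^ 2 + ψ t p ^ 2 = 0 := hall p
    have p1 : 0 ≤ τ * ‖B t p‖ ^ 2 := by positivity
    have p2 : 0 ≤ ψ t p ^ 2 := by positivity
    have q1 : τ * ‖B t p‖ ^ 2 = 0 := by linarith
    have q2 : ψ t p ^ 2 = 0 := by linarith
    constructor
    · have : B t p = 0 := by simpa [hτ.ne'] using q1
      exact sub_eq_zero.mp this
    · have : ψ t p = 0 := by simpa using q2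
      exact sub_eq_zero.mp this
  exact ⟨funext fun p => (hfin p).1, funext fun p => (hfin p).2⟩
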